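/- arXiv:math/0208143 — 5 statements merged into one kernel-verified Lean document; each statement's English description precedes it below -/
import Mathlib

section
/- Let c, n be positive integers, let B be a c×c complex matrix and let Ψ₀ be a c×n complex matrix. Assume that for every λ ∈ ℂ, every row vector w ∈ ℂ^{1×c} satisfying wB = λw and wΨ₀ = 0 must be zero (i.e. the map w ↦ wΨ₀ is injective on the left λ-eigenspace of B, for every eigenvalue λ of B). Then there exists a linear subspace Ŵ of Mat_{c×c}(ℂ) with Ŵ ⊆ R(Ψ₀) such that Mat_{c×c}(ℂ) is the direct sum of the range of ad_B and Ŵ, i.e. range(ad_B) ∩ Ŵ = {0} and range(ad_B) + Ŵ = Mat_{c×c}(ℂ). -/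
open Matrix in
/-- Every linear functional on square matrices is of the form `M ↦ trace (Z * M)`. -/
theorem Matrix.exists_eq_trace_mul {m K : Type*} [Fintype m] [DecidableEq m] [CommSemiring K]
    (f : Matrix m m K →ₗ[K] K) : ∃ Z : Matrix m m K, ∀ M, f M = trace (Z * M) := by
  refine ⟨of fun i j => f (single j i 1), fun M => ?_⟩
  have key : f = traceLinearMap m K K ∘ₗ
      LinearMap.mulLeft K (of fun i j => f (single j i 1)) := by
    refine ext_linearMap K fun i j => LinearMap.ext_ring ?_
    simp [trace_mul_single]
  exact LinearMap.congr_fun key M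

open Matrix in
/-- A matrix commuting with `B` and annihilating `Ψ` from the left vanishes if no left eigenvector
of `B` annihilates `Ψ`. -/
theorem Matrix.eq_zero_of_commute_of_mul_eq_zero {m n K : Type*} [Fintype m] [Field K]
    [IsAlgClosed K] {B Z : Matrix m m K} {Ψ : Matrix m n K}
    (h : ∀ (μ : K) (w : m → K), w ᵥ* B = μ • w → w ᵥ* Ψ = 0 → w = 0)
    (hB : Commute Z B) (hΨ : Z * Ψ = 0) : Z = 0 := by
  classical
  by_contra hZ
  let V := LinearMap.range Z.vecMulLinear
  have hV : ∀ v ∈ V, B.vecMulLinear v ∈ V := by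
    rintro _ ⟨v, rfl⟩
    exact ⟨v ᵥ* B, by simp [vecMul_vecMul, hB.eq]⟩
  have hne : V ≠ ⊥ := fun hbot => hZ <| by
    ext i j
    have hi : Pi.single i 1 ᵥ* Z = 0 := (Submodule.eq_bot_iff V).1 hbot _ ⟨Pi.single i 1, rfl⟩
    simpa using congrFun hi j
  have : Nontrivial V := Submodule.nontrivial_iff_ne_bot.2 hne
  obtain ⟨μ, hμ⟩ := Module.End.exists_eigenvalue (B.vecMulLinear.restrict hV)
  obtain ⟨⟨_, v, rfl⟩, hw⟩ := hμ.exists_hasEigenvector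
  refine hw.2 (Subtype.ext (h μ _ (congrArg Subtype.val hw.apply_eq_smul) ?_))
  simp [vecMul_vecMul, hΨ]

open Matrix in
/-- If no left eigenvector of `B` annihilates `Ψ`, then the range of `M ↦ B * M - M * B` and the
matrices `Ψ * R` together span all square matrices. -/
theorem Matrix.range_commutator_sup_range_mulLeft_eq_top {m n K : Type*} [Fintype m] [DecidableEq m]
    [Fintype n] [Field K] [IsAlgClosed K] {B : Matrix m m K} {Ψ : Matrix m n K}
    (h : ∀ (μ : K) (w : m → K), w ᵥ* B = μ • w → w ᵥ* Ψ = 0 → w = 0) :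
    LinearMap.range (LinearMap.mulLeft K B - LinearMap.mulRight K B) ⊔
      LinearMap.range (mulLeftLinearMap m K Ψ) = ⊤ := by
  classical
  by_contra hlt
  obtain ⟨f, hf, hle⟩ := Submodule.exists_le_ker_of_lt_top _ (lt_top_iff_ne_top.2 hlt)
  obtain ⟨Z, hZ⟩ := exists_eq_trace_mul f
  rw [sup_le_iff] at hle
  have hB : Commute Z B := by
    refine ext_iff_trace_mul_right.2 fun X => ?_
    have hX : f (B * X - X * B) = 0 := hle.1 ⟨X, rfl⟩
    rw [hZ, mul_sub, trace_sub, sub_eq_zero, ← mul_assoc, trace_mul_cycle'] at hX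
    rw [hX, mul_assoc]
  have hΨ : Z * Ψ = 0 := by
    ext i j
    have hR : f (Ψ * single j i (1 : K)) = 0 := hle.2 ⟨single j i 1, rfl⟩
    simpa [hZ, ← Matrix.mul_assoc, trace_mul_single] using hR
  refine hf (LinearMap.ext fun M => ?_)
  simp [hZ, eq_zero_of_commute_of_mul_eq_zero h hB hΨ]

/-- Proposition 6.1: if, for every `λ ∈ ℂ`, the only left `λ`-eigenvector `w` of `B` with
`w Ψ₀ = 0` is `w = 0`, then there is a subspace `Ŵ` of `Mat_{c×c}(ℂ)`, contained in the space
`R(Ψ₀)` of matrices whose columns lie in the column space of `Ψ₀`, which is a complement to the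
range of `ad_B : M ↦ BM - MB`. -/
theorem stmt_0 (c n : ℕ) (hc : 0 < c) (hn : 0 < n)
    (B : Matrix (Fin c) (Fin c) ℂ) (Ψ₀ : Matrix (Fin c) (Fin n) ℂ)
    (h : ∀ (lam : ℂ) (w : Fin c → ℂ),
      Matrix.vecMul w B = lam • w → Matrix.vecMul w Ψ₀ = 0 → w = 0) :
    ∃ W : Submodule ℂ (Matrix (Fin c) (Fin c) ℂ),
      (∀ M ∈ W, ∃ R : Matrix (Fin n) (Fin c) ℂ, M = Ψ₀ * R) ∧
      LinearMap.range (LinearMap.mulLeft ℂ B - LinearMap.mulRight ℂ B) ⊓ W = ⊥ ∧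
      LinearMap.range (LinearMap.mulLeft ℂ B - LinearMap.mulRight ℂ B) ⊔ W = ⊤ := by
  obtain ⟨W, hW, hcompl⟩ := (codisjoint_iff.2
    (Matrix.range_commutator_sup_range_mulLeft_eq_top h)).symm.exists_isCompl
  refine ⟨W, fun M hM => ?_, hcompl.symm.inf_eq_bot, hcompl.symm.sup_eq_top⟩
  obtain ⟨R, hR⟩ := hW hM
  exact ⟨R, hR.symm⟩
end

section
/- Let c, p be positive integers, B ∈ Mat_{c×c}(ℂ), α₀ ∈ ℂ^p, and let 𝓑 : ℂ^p → Mat_{c×c}(ℂ) be a map which is analytic on a neighborhood of α₀ and satisfies 𝓑(α₀) = B. Suppose that every matrix in Mat_{c×c}(ℂ) can be written as (BX − XB) + D𝓑(α₀)·v for some X ∈ Mat_{c×c}(ℂ) and some v ∈ ℂ^p, where D𝓑(α₀) denotes the derivative of 𝓑 at α₀. Then 𝓑 is a versal unfolding of B: for every positive integer q, every β₀ ∈ ℂ^q, and every map A : ℂ^q → Mat_{c×c}(ℂ) analytic on a neighborhood of β₀ with A(β₀) = B, there exist a neighborhood U of β₀, an analytic map φ : U → ℂ^p with φ(β₀) =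 α₀, and an analytic map C : U → Mat_{c×c}(ℂ) with C(β₀) = I_c, such that C(β) is invertible and A(β) = C(β)·𝓑(φ(β))·C(β)^{-1} for all β ∈ U. -/
attribute [local instance] Matrix.normedAddCommGroup Matrix.normedSpace

/-- A continuous linear map onto a finite-dimensional space has a continuous linear right
inverse. -/
theorem ContinuousLinearMap.exists_rightInverse_of_surjective_finiteDimensional {E F : Type*}
    [NormedAddCommGroup E] [NormedSpace ℂ E] [NormedAddCommGroup F] [NormedSpace ℂ F]
    [FiniteDimensional ℂ F] (T : E →L[ℂ] F) (hT : Function.Surjective T) :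
    ∃ S : F →L[ℂ] E, ∀ y, T (S y) = y := by
  obtain ⟨s, hs⟩ := T.toLinearMap.exists_rightInverse_of_surjective (LinearMap.range_eq_top.2 hT)
  exact ⟨s.toContinuousLinearMap, fun y => LinearMap.congr_fun hs y⟩

/-- Analytic implicit function theorem, for an equation whose partial derivative in the second
variable is the identity. -/
theorem AnalyticAt.exists_implicitFunction {E F : Type*} [NormedAddCommGroup E]
    [NormedSpace ℂ E] [CompleteSpace E] [NormedAddCommGroup F] [NormedSpace ℂ F] [CompleteSpace F]
    {f : E × F → F} {x : E} {y : F} (hf : AnalyticAt ℂ f (x, y))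
    (hf' : HasFDerivAt (fun z => f (x, z)) (.id ℂ F) y) :
    ∃ ψ : E → F, AnalyticAt ℂ ψ x ∧ ψ x = y ∧ ∀ᶠ z in nhds x, f (z, ψ z) = f (x, y) := by
  have hc : ContDiffAt ℂ ⊤ f (x, y) := hf.contDiffAt
  have hinr : fderiv ℂ f (x, y) ∘L .inr ℂ E F = .id ℂ F :=
    (hf.differentiableAt.hasFDerivAt.comp y (hasFDerivAt_prodMk_right x y)).unique hf'
  have hinv : (fderiv ℂ f (x, y) ∘L .inr ℂ E F).IsInvertible :=
    ⟨.refl ℂ F, by rw [hinr]; rfl⟩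
  exact ⟨hc.implicitFunction (by simp) hinv,
    (hc.contDiffAt_implicitFunction _ hinv).analyticAt,
    hc.implicitFunction_apply_self _ hinv, hc.eventually_apply_implicitFunction _ hinv⟩

/-- If every element of a finite-dimensional space `F` with a bilinear unital product `μ` has the
form `(b X - X b) + D v`, where `D` is the derivative of the analytic map `g` at `a` and `b = g a`,
then every analytic map `A` with `A x = b` intertwines with a pullback of `g` near `x`. -/
theorem AnalyticAt.exists_intertwining {E F V : Type*} [NormedAddCommGroup E]
    [NormedSpace ℂ E] [CompleteSpace E] [NormedAddCommGroup F] [NormedSpace ℂ F]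
    [FiniteDimensional ℂ F] [NormedAddCommGroup V] [NormedSpace ℂ V]
    (μ : F →L[ℂ] F →L[ℂ] F) {e : F} (he : ∀ y, μ e y = y) (he' : ∀ y, μ y e = y)
    {g : V → F} {a : V} (hg : AnalyticAt ℂ g a)
    (hsurj : ∀ Y : F, ∃ (X : F) (v : V), Y = (μ (g a) X - μ X (g a)) + fderiv ℂ g a v)
    {A : E → F} {x : E} (hA : AnalyticAt ℂ A x) (hAx : A x = g a) :
    ∃ (φ : E → V) (C : E → F), AnalyticAt ℂ φ x ∧ AnalyticAt ℂ C x ∧ φ x = a ∧ C x = e ∧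
      ∀ᶠ z in nhds x, μ (A z) (C z) = μ (C z) (g (φ z)) := by
  have : CompleteSpace F := FiniteDimensional.complete ℂ F
  let T : F × V →L[ℂ] F :=
    (μ (g a) - μ.flip (g a)) ∘L .fst ℂ F V + fderiv ℂ g a ∘L .snd ℂ F V
  obtain ⟨S, hS⟩ := T.exists_rightInverse_of_surjective_finiteDimensional fun Y => by
    obtain ⟨X, v, h⟩ := hsurj Y
    exact ⟨(X, v), by simp [T, h]⟩
  let L : F →L[ℂ] F := .fst ℂ F V ∘L S
  let K : F →L[ℂ] V := .snd ℂ F V ∘L S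
  have hLK : ∀ Y, (μ (g a) (L Y) - μ (L Y) (g a)) + fderiv ℂ g a (K Y) = Y := fun Y => by
    simpa [T, L, K] using hS Y
  let f : E × F → F := fun z => μ (A z.1) (e + L z.2) - μ (e + L z.2) (g (a - K z.2))
  have hf : AnalyticAt ℂ f (x, 0) := by
    have h1 : AnalyticAt ℂ (fun z : E × F => A z.1) (x, 0) :=
      AnalyticAt.fun_comp (g := A) hA analyticAt_fst
    have h2 : AnalyticAt ℂ (fun z : E × F => e + L z.2) (x, 0) :=
      analyticAt_const.add ((L.analyticAt _).fun_comp analyticAt_snd)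
    have h3 : AnalyticAt ℂ (fun z : E × F => g (a - K z.2)) (x, 0) :=
      AnalyticAt.fun_comp (g := g) (by simpa using hg)
        (analyticAt_const.sub ((K.analyticAt _).fun_comp analyticAt_snd))
    have hμ (w : F × F) : AnalyticAt ℂ (fun z : F × F => μ z.1 z.2) w := μ.analyticAt_bilinear w
    exact (AnalyticAt.fun_comp (g := fun z : F × F => μ z.1 z.2) (hμ _) (h1.prod h2)).sub
      (AnalyticAt.fun_comp (g := fun z : F × F => μ z.1 z.2) (hμ _) (h2.prod h3))
  have hf' : HasFDerivAt (fun y => f (x, y)) (.id ℂ F) 0 := by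
    have h2 : HasFDerivAt (fun y => e + L y) L 0 := L.hasFDerivAt.const_add e
    have h3 : HasFDerivAt (fun y => g (a - K y)) (fderiv ℂ g a ∘L (-K)) 0 :=
      HasFDerivAt.comp (g := g) 0 (by simpa using hg.differentiableAt.hasFDerivAt)
        (K.hasFDerivAt.const_sub a)
    refine ((μ.hasFDerivAt_of_bilinear (hasFDerivAt_const (A x) 0) h2).sub
      (μ.hasFDerivAt_of_bilinear h2 h3)).congr_fderiv ?_
    ext1 Y
    refine Eq.trans ?_ (hLK Y)
    simp [hAx, he]
    abel
  obtain ⟨ψ, hψ, hψx, hev⟩ := hf.exists_implicitFunction hf'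
  refine ⟨fun z => a - K (ψ z), fun z => e + L (ψ z),
    analyticAt_const.sub ((K.analyticAt _).fun_comp hψ),
    analyticAt_const.add ((L.analyticAt _).fun_comp hψ), by simp [hψx], by simp [hψx], ?_⟩
  filter_upwards [hev] with z hz
  exact sub_eq_zero.1 (by simpa [f, hAx, he, he'] using hz)

/-- Arnold's sufficient criterion for versality (Proposition 1.1): if every `c × c` complex
matrix can be written as `(BX - XB) + D𝓑(α₀)·v`, then the analytic unfolding `𝓑` of
`B = 𝓑(α₀)` is versal: every analytic unfolding `A` of `B` (with `A(β₀) = B`) is, on a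
neighborhood `U` of `β₀`, of the form `A(β) = C(β) 𝓑(φ(β)) C(β)⁻¹` with `φ`, `C` analytic,
`φ(β₀) = α₀`, `C(β₀) = I`, and `C(β)` invertible. -/
theorem stmt_1 (c p : ℕ) (hc : 0 < c) (hp : 0 < p)
    (B : Matrix (Fin c) (Fin c) ℂ) (α₀ : Fin p → ℂ)
    (𝓑 : (Fin p → ℂ) → Matrix (Fin c) (Fin c) ℂ)
    (h𝓑 : AnalyticAt ℂ 𝓑 α₀) (h𝓑₀ : 𝓑 α₀ = B)
    (htransv : ∀ Y : Matrix (Fin c) (Fin c) ℂ,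
      ∃ (X : Matrix (Fin c) (Fin c) ℂ) (v : Fin p → ℂ),
        Y = (B * X - X * B) + fderiv ℂ 𝓑 α₀ v) :
    ∀ (q : ℕ), 0 < q → ∀ (β₀ : Fin q → ℂ) (A : (Fin q → ℂ) → Matrix (Fin c) (Fin c) ℂ),
      AnalyticAt ℂ A β₀ → A β₀ = B →
      ∃ (U : Set (Fin q → ℂ)) (φ : (Fin q → ℂ) → (Fin p → ℂ))
        (C : (Fin q → ℂ) → Matrix (Fin c) (Fin c) ℂ),
        IsOpen U ∧ β₀ ∈ U ∧
        (∀ β ∈ U, AnalyticAt ℂ φ β) ∧ (∀ β ∈ U, AnalyticAt ℂ C β) ∧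
        φ β₀ = α₀ ∧ C β₀ = 1 ∧
        ∀ β ∈ U, IsUnit (C β) ∧ A β = C β * 𝓑 (φ β) * (C β)⁻¹ := by
  intro q _ β₀ A hA hA₀
  let μ : Matrix (Fin c) (Fin c) ℂ →L[ℂ] Matrix (Fin c) (Fin c) ℂ →L[ℂ]
      Matrix (Fin c) (Fin c) ℂ :=
    (LinearMap.mul ℂ (Matrix (Fin c) (Fin c) ℂ)).toContinuousBilinearMap
  obtain ⟨φ, C, hφ, hC, hφ₀, hC₀, hev⟩ := AnalyticAt.exists_intertwining μ
    (e := 1) Matrix.one_mul Matrix.mul_one h𝓑 (by rw [h𝓑₀]; exact htransv) hA (hA₀.trans h𝓑₀.symm)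
  have hunit : ∀ᶠ β in nhds β₀, (C β).det ≠ 0 :=
    (continuous_id.matrix_det.continuousAt.comp hC.continuousAt).eventually_ne (by simp [hC₀])
  obtain ⟨U, hU, hUo, hβ₀⟩ := eventually_nhds_iff.1
    (hφ.eventually_analyticAt.and (hC.eventually_analyticAt.and (hunit.and hev)))
  refine ⟨U, φ, C, hUo, hβ₀, fun β hβ => (hU β hβ).1, fun β hβ => (hU β hβ).2.1,
    hφ₀, hC₀, fun β hβ => ?_⟩
  obtain ⟨-, -, hdet, heq⟩ := hU β hβ
  have hdet' : IsUnit (C β).det := isUnit_iff_ne_zero.2 hdet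
  have heq' : A β * C β = C β * 𝓑 (φ β) := heq
  exact ⟨(Matrix.isUnit_iff_isUnit_det _).2 hdet', by
    rw [← heq', Matrix.mul_nonsing_inv_cancel_right _ _ hdet']⟩
end

section
/- Let I be an interval in ℝ, let n, c be positive integers, and suppose φ₁, …, φ_c : I → ℂⁿ are continuous functions which are linearly independent over ℂ (as elements of the space C(I, ℂⁿ) of continuous functions). For θ ∈ I let Φ_c(θ) denote the n×c matrix with columns φ₁(θ), …, φ_c(θ). Fix τ₀ ∈ I and let q be the rank of Φ_c(τ₀). Then there exist c−q distinct points τ₁, …, τ_{c−q} ∈ I \ {τ₀} such that the n(c−q+1) × c matrix col(Φ_c(τ₀), Φ_c(τ₁), …, Φ_c(τ_{c−q})), obtained by stacking the matrices Φ_c(τ₀), …, Φ_c(τ_{c−q}), has rank c. -/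
/-- In a finite-dimensional space, a family of linear maps with trivial common kernel on `K` has a
subfamily of at most `finrank K` members with trivial common kernel on `K`. -/
theorem exists_finset_card_le_finrank_of_forall_apply_eq_zero {𝕜 V W ι : Type*} [Field 𝕜]
    [AddCommGroup V] [Module 𝕜 V] [FiniteDimensional 𝕜 V] [AddCommGroup W] [Module 𝕜 W]
    (E : ι → V →ₗ[𝕜] W) (I : Set ι) (hE : ∀ v, (∀ x ∈ I, E x v = 0) → v = 0)
    (K : Submodule 𝕜 V) :
    ∃ T : Finset ι, ↑T ⊆ I ∧ T.card ≤ Module.finrank 𝕜 K ∧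
      ∀ v ∈ K, (∀ x ∈ T, E x v = 0) → v = 0 := by
  classical
  induction hd : Module.finrank 𝕜 K using Nat.strong_induction_on generalizing K with
  | _ d ih =>
    by_cases hK : K = ⊥
    · exact ⟨∅, by simp, by simp, fun v hv _ => by simpa [hK] using hv⟩
    obtain ⟨v, hvK, hv⟩ := K.exists_mem_ne_zero_of_ne_bot hK
    obtain ⟨x, hxI, hx⟩ : ∃ x ∈ I, E x v ≠ 0 := by
      by_contra! h
      exact hv (hE v h)
    have hlt : K ⊓ (E x).ker < K :=
      lt_of_le_of_ne inf_le_left fun h => hx (h.symm ▸ hvK : v ∈ K ⊓ (E x).ker).2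
    have hfin := Submodule.finrank_lt_finrank_of_lt hlt
    obtain ⟨T, hTI, hTc, hT⟩ := ih _ (hd ▸ hfin) (K ⊓ (E x).ker) rfl
    refine ⟨insert x T, by simp [Set.insert_subset_iff, hxI, hTI], ?_, fun w hw h => ?_⟩
    · have := Finset.card_insert_le x T
      omega
    · exact hT w ⟨hw, h x (Finset.mem_insert_self x T)⟩
        fun y hy => h y (Finset.mem_insert_of_mem hy)

/-- A matrix acting injectively has full column rank. -/
theorem Matrix.rank_eq_card_of_forall_mulVec_eq_zero {𝕜 m n : Type*} [Field 𝕜] [Fintype m]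
    [Fintype n] (A : Matrix m n 𝕜) (hA : ∀ v, A.mulVec v = 0 → v = 0) :
    A.rank = Fintype.card n := by
  have hinj : Function.Injective A.mulVecLin := by
    rw [← LinearMap.ker_eq_bot, LinearMap.ker_eq_bot']
    exact hA
  rw [Matrix.rank, LinearMap.finrank_range_of_inj hinj, Module.finrank_fintype_fun_eq_card]


/-- Lemma 7.1 (Hale; Faria–Magalhães): let `φ₁, …, φ_c : I → ℂⁿ` be continuous functions on an
interval `I ⊆ ℝ`, linearly independent as elements of `C(I, ℂⁿ)`. For `θ ∈ I` let `Φ_c(θ)` be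
the `n × c` matrix with columns `φ₁(θ), …, φ_c(θ)`, fix `τ₀ ∈ I`, and let
`q = rank Φ_c(τ₀)`. Then there are `c - q` distinct points `τ₁, …, τ_{c-q} ∈ I \ {τ₀}` such
that the stacked `n(c-q+1) × c` matrix `col(Φ_c(τ₀), …, Φ_c(τ_{c-q}))` has rank `c`.
Distinctness of `τ₀, τ₁, …, τ_{c-q}` is expressed as injectivity of `Fin.cases τ₀ τ`. -/
theorem stmt_3 (n c : ℕ) (hn : 0 < n) (hc : 0 < c)
    (I : Set ℝ) (hI : I.OrdConnected)
    (φ : Fin c → ℝ → (Fin n → ℂ))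
    (hcont : ∀ i, ContinuousOn (φ i) I)
    (hli : LinearIndependent ℂ (fun i : Fin c => fun x : I => φ i (x : ℝ)))
    (τ₀ : ℝ) (hτ₀ : τ₀ ∈ I) :
    ∃ τ : Fin (c - (Matrix.of fun (a : Fin n) (i : Fin c) => φ i τ₀ a).rank) → ℝ,
      (∀ k, τ k ∈ I \ {τ₀}) ∧
      Function.Injective τ ∧
      (Matrix.of
        fun (pp : Fin (c - (Matrix.of fun (a : Fin n) (i : Fin c) => φ i τ₀ a).rank + 1) × Fin n)
            (i : Fin c) =>
          φ i (Fin.cases (motive := fun _ => ℝ) τ₀ τ pp.1) pp.2).rank = c := by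
  classical
  set E : ℝ → (Fin c → ℂ) →ₗ[ℂ] (Fin n → ℂ) := fun x =>
    (Matrix.of fun (a : Fin n) (i : Fin c) => φ i x a).mulVecLin with hEdef
  have hE : ∀ v, (∀ x ∈ I, E x v = 0) → v = 0 := by
    intro v hv
    funext i
    refine Fintype.linearIndependent_iff.1 hli v ?_ i
    funext x a
    simpa [hEdef, Matrix.mulVec, dotProduct, mul_comm] using congrFun (hv x x.2) a
  have hK : Module.finrank ℂ (E τ₀).ker =
      c - (Matrix.of fun (a : Fin n) (i : Fin c) => φ i τ₀ a).rank := by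
    have := LinearMap.finrank_range_add_finrank_ker (E τ₀)
    rw [Module.finrank_fin_fun] at this
    rw [Matrix.rank]
    exact Nat.eq_sub_of_add_eq' this
  obtain ⟨T₀, hT₀I, hT₀c, hT₀⟩ :=
    exists_finset_card_le_finrank_of_forall_apply_eq_zero E I hE (E τ₀).ker
  rw [hK] at hT₀c
  generalize c - (Matrix.of fun (a : Fin n) (i : Fin c) => φ i τ₀ a).rank = d at *
  obtain ⟨T, hTI, hTc, hT⟩ : ∃ T : Finset ℝ, ↑T ⊆ I \ {τ₀} ∧ T.card = d ∧
      ∀ v ∈ (E τ₀).ker, (∀ x ∈ T, E x v = 0) → v = 0 := by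
    have hsub : (↑(T₀.erase τ₀) : Set ℝ) ⊆ I \ {τ₀} := by
      rw [Finset.coe_erase]
      exact Set.sdiff_subset_sdiff_left hT₀I
    have hker : ∀ v ∈ (E τ₀).ker, (∀ x ∈ T₀.erase τ₀, E x v = 0) → v = 0 := fun v hv h =>
      hT₀ v hv fun x hx => by
        by_cases hxτ : x = τ₀
        · exact hxτ ▸ hv
        · exact h x (Finset.mem_erase.2 ⟨hxτ, hx⟩)
    have hcard : (T₀.erase τ₀).card ≤ d := (Finset.card_erase_le).trans hT₀c
    rcases Nat.eq_zero_or_pos d with rfl | hd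
    · exact ⟨_, hsub, by omega, hker⟩
    have hinf : I.Infinite := by
      have hne : (E τ₀).ker ≠ ⊥ := fun h => by rw [h, finrank_bot] at hK; omega
      obtain ⟨v, hvK, hv⟩ := Submodule.exists_mem_ne_zero_of_ne_bot hne
      obtain ⟨x, hxI, hx⟩ : ∃ x ∈ I, E x v ≠ 0 := by
        by_contra! h
        exact hv (hE v h)
      have hxτ : τ₀ ≠ x := fun h => hx (h ▸ hvK)
      refine Set.Infinite.mono (hI.uIcc_subset hτ₀ hxI) (Set.Icc_infinite ?_)
      simpa using hxτ.symm
    obtain ⟨U, hUI, hUc⟩ := ((hinf.sdiff (Set.finite_singleton τ₀)).sdiff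
      (T₀.erase τ₀).finite_toSet).exists_subset_card_eq (d - (T₀.erase τ₀).card)
    refine ⟨T₀.erase τ₀ ∪ U, ?_, ?_, fun v hv h => hker v hv fun x hx =>
      h x (Finset.mem_union_left _ hx)⟩
    · rw [Finset.coe_union]
      exact Set.union_subset hsub (hUI.trans Set.sdiff_subset)
    · rw [Finset.card_union_of_disjoint, hUc, Nat.add_sub_cancel' hcard]
      exact Finset.disjoint_right.2 fun x hx => (hUI hx).2
  refine ⟨T.orderEmbOfFin hTc, fun k => hTI (T.orderEmbOfFin_mem hTc k),
    (T.orderEmbOfFin hTc).injective, ?_⟩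
  refine (Matrix.rank_eq_card_of_forall_mulVec_eq_zero _ fun v hv => ?_).trans (Fintype.card_fin c)
  refine hT v ?_ fun x hx => ?_
  · exact funext fun a => congrFun hv (0, a)
  · obtain ⟨k, rfl⟩ : x ∈ Set.range (T.orderEmbOfFin hTc) := by simpa using hx
    exact funext fun a => congrFun hv (k.succ, a)
end

section
/- Let V and W be vector spaces over ℂ, let ι : V → W be an injective linear map, let A : V → W be a linear map, and let B be a c×c complex matrix. Define the linear map J : V^c → W^c by (Jv)_j = A(v_j) − Σ_{i=1}^{c} B_{ij} ι(v_i) for v = (v₁,…,v_c) ∈ V^c. If for every eigenvalue λ ∈ ℂ of B (i.e. every root of the characteristic polynomial of B) the linear map A − λι : V → W is injective, then J is injective. -/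
/-- If `A ∘ L = ι ∘ L ∘ f` for an endomorphism `f` of a finite-dimensional space over an
algebraically closed field, and `A - μ ι` is injective for every eigenvalue `μ` of `f`,
then `L = 0`. -/
theorem LinearMap.eq_zero_of_comp_eq_comp_comp {K M V W : Type*} [Field K] [IsAlgClosed K]
    [AddCommGroup M] [Module K M] [FiniteDimensional K M] [AddCommGroup V] [Module K V]
    [AddCommGroup W] [Module K W] {ι A : V →ₗ[K] W} {f : Module.End K M} {L : M →ₗ[K] V}
    (hL : A ∘ₗ L = ι ∘ₗ L ∘ₗ f)
    (h : ∀ μ : K, f.HasEigenvalue μ → Function.Injective (A - μ • ι : V →ₗ[K] W)) :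
    L = 0 := by
  rw [← LinearMap.ker_eq_top, eq_top_iff, ← f.iSup_maxGenEigenspace_eq_top]
  refine iSup_le fun μ x hx => ?_
  rw [Module.End.mem_maxGenEigenspace] at hx
  obtain ⟨k, hk⟩ := hx
  rw [LinearMap.mem_ker]
  by_cases hμ : f.HasEigenvalue μ
  · induction k generalizing x with
    | zero => simp_all
    | succ k ih =>
      have hy : L ((f - μ • 1) x) = 0 := ih _ (by rwa [pow_succ] at hk)
      apply h μ hμ
      have hAx : A (L x) = ι (L (f x)) := LinearMap.congr_fun hL x
      have hfx : L (f x) = μ • L x := by simpa [sub_eq_zero] using hy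
      simp [hAx, hfx]
  · have hinj : Function.Injective (f - μ • 1 : Module.End K M) := by
      rw [← LinearMap.ker_eq_bot]
      simpa [Module.End.hasEigenvalue_iff, Module.End.eigenspace_def,
        Algebra.algebraMap_eq_smul_one] using hμ
    have hinj_pow : Function.Injective ((f - μ • 1) ^ k : Module.End K M) := by
      rw [Module.End.coe_pow]
      exact hinj.iterate k
    rw [hinj_pow (hk.trans (map_zero _).symm), map_zero]

/-- Injectivity step in the proof of Proposition 4.1: if `ι : V → W` is an injective linear
map, `A : V → W` is linear, `B` is a `c × c` complex matrix, and `A - λ ι` is injective for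
every root `λ` of the characteristic polynomial of `B`, then the map
`J : V^c → W^c`, `(Jv)_j = A (v j) - ∑ i, B i j • ι (v i)` (i.e. `J v = A v - v B`),
is injective. -/
theorem stmt_4 (c : ℕ) (hc : 0 < c) (V W : Type*) [AddCommGroup V] [Module ℂ V]
    [AddCommGroup W] [Module ℂ W] (ι : V →ₗ[ℂ] W) (hι : Function.Injective ι)
    (A : V →ₗ[ℂ] W) (B : Matrix (Fin c) (Fin c) ℂ)
    (h : ∀ lam : ℂ, (Matrix.charpoly B).IsRoot lam →
      Function.Injective (A - lam • ι : V →ₗ[ℂ] W)) :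
    Function.Injective
      (fun (v : Fin c → V) => fun (j : Fin c) => A (v j) - ∑ i, B i j • ι (v i)) := by
  let J : (Fin c → V) →ₗ[ℂ] (Fin c → W) := LinearMap.pi fun j =>
    A ∘ₗ LinearMap.proj j - ∑ i, B i j • ι ∘ₗ LinearMap.proj i
  have hJ : ⇑J = fun v j => A (v j) - ∑ i, B i j • ι (v i) := by
    ext v j
    simp [J]
  rw [← hJ, injective_iff_map_eq_zero]
  intro v hv
  have hAv (j : Fin c) : A (v j) = ∑ i, B i j • ι (v i) := by
    rw [hJ] at hv
    exact sub_eq_zero.mp (congrFun hv j)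
  have hL : Fintype.linearCombination ℂ v = 0 := by
    refine LinearMap.eq_zero_of_comp_eq_comp_comp (ι := ι) (A := A) (f := B.toLin') ?_ ?_
    · ext j
      simp [Fintype.linearCombination_apply, hAv]
    · intro μ hμ
      rw [Module.End.hasEigenvalue_iff_isRoot_charpoly, Matrix.charpoly_toLin'] at hμ
      exact h μ hμ
  ext j
  simpa using LinearMap.congr_fun hL (Pi.single j 1)
end

section
/- Let V and W be vector spaces over ℂ, let ι : V → W be an injective linear map, let A : V → W be a linear map, and let B be a c×c complex matrix. Define the linear map J : V^c → W^c by (Jv)_j = A(v_j) − Σ_{i=1}^{c} B_{ij} ι(v_i) for v = (v₁,…,v_c) ∈ V^c. If for every eigenvalue λ ∈ ℂ of B (i.e. every root of the characteristic polynomial of B) the linear map A − λι : V → W is surjective, then J is surjective. -/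
/-- The Sylvester-type operator `v ↦ A v - v B` on rows of vectors. -/
def sylvesterMap {K V W n : Type*} [Field K] [AddCommGroup V] [Module K V] [AddCommGroup W]
    [Module K W] [Fintype n] (ι A : V →ₗ[K] W) (B : Matrix n n K) : (n → V) →ₗ[K] (n → W) where
  toFun v j := A (v j) - ∑ i, B i j • ι (v i)
  map_add' v v' := by
    ext j
    simp only [Pi.add_apply, map_add, smul_add, Finset.sum_add_distrib]
    abel
  map_smul' a v := by
    ext j
    simp only [Pi.smul_apply, map_smul, RingHom.id_apply, smul_sub, Finset.smul_sum,
      smul_comm a]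

theorem sylvesterMap_smul {K V W n : Type*} [Field K] [AddCommGroup V] [Module K V]
    [AddCommGroup W] [Module K W] [Fintype n] (ι A : V →ₗ[K] W) (B : Matrix n n K)
    (u : n → K) (v : V) (lam : K) :
    sylvesterMap ι A B (fun j => u j • v) =
      (fun j => u j • (A - lam • ι) v) -
        fun j => (B.transpose.mulVec u j - lam * u j) • ι v := by
  ext j
  simp only [sylvesterMap, LinearMap.coe_mk, AddHom.coe_mk, Pi.sub_apply, map_smul,
    LinearMap.sub_apply, LinearMap.smul_apply, Matrix.mulVec, dotProduct,
    Matrix.transpose_apply, sub_smul, smul_sub, Finset.sum_smul, smul_smul, mul_comm lam]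
  abel

/-- If `A - lam • ι` is surjective, the range of the Sylvester map contains all pure tensors
`u ⊗ w` with `u` a generalized left eigenvector of `B` for `lam`. -/
theorem smul_mem_range_sylvesterMap {K V W n : Type*} [Field K] [AddCommGroup V] [Module K V]
    [AddCommGroup W] [Module K W] [Fintype n] [DecidableEq n] (ι A : V →ₗ[K] W)
    (B : Matrix n n K) {lam : K} (h : Function.Surjective (A - lam • ι : V →ₗ[K] W)) (k : ℕ)
    (u : n → K) (hu : ((B.transpose.toLin' - lam • (1 : Module.End K (n → K))) ^ k) u = 0)
    (w : W) : (fun j => u j • w) ∈ LinearMap.range (sylvesterMap ι A B) := by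
  induction k generalizing u w with
  | zero =>
    obtain rfl : u = 0 := by simpa using hu
    exact ⟨0, by ext; simp⟩
  | succ k ih =>
    obtain ⟨v, rfl⟩ := h w
    rw [pow_succ, Module.End.mul_apply] at hu
    have key := ih _ hu (ι v)
    have hsub := sylvesterMap_smul ι A B u v lam
    rw [eq_sub_iff_add_eq] at hsub
    rw [← hsub]
    exact Submodule.add_mem _ (LinearMap.mem_range_self _ _) key

/-- If `A - lam • ι` is surjective for all eigenvalues `lam` of `B`, the Sylvester map is
surjective. -/
theorem sylvesterMap_surjective {K V W n : Type*} [Field K] [IsAlgClosed K] [AddCommGroup V]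
    [Module K V] [AddCommGroup W] [Module K W] [Fintype n] [DecidableEq n] (ι A : V →ₗ[K] W)
    (B : Matrix n n K)
    (h : ∀ lam : K, B.charpoly.IsRoot lam → Function.Surjective (A - lam • ι : V →ₗ[K] W)) :
    Function.Surjective (sylvesterMap ι A B) := by
  let S : Submodule K (n → K) :=
    ⨅ w : W, (LinearMap.range (sylvesterMap ι A B)).comap
      (LinearMap.pi fun j => (LinearMap.toSpanSingleton K W w).comp (LinearMap.proj j))
  have hS (u : n → K) : u ∈ S ↔
      ∀ w : W, (fun j => u j • w) ∈ LinearMap.range (sylvesterMap ι A B) := by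
    simp only [S, Submodule.mem_iInf, Submodule.mem_comap]
    rfl
  have hle (lam : K) : Module.End.maxGenEigenspace B.transpose.toLin' lam ≤ S := by
    intro u hu
    by_cases hu0 : u = 0
    · exact hu0 ▸ S.zero_mem
    have heig : Module.End.HasEigenvalue B.transpose.toLin' lam := by
      refine Module.End.HasUnifEigenvalue.lt (k := ⊤) one_pos ?_
      exact (Submodule.ne_bot_iff _).mpr ⟨u, hu, hu0⟩
    rw [Module.End.hasEigenvalue_iff_isRoot_charpoly, Matrix.charpoly_toLin',
      Matrix.charpoly_transpose] at heig
    obtain ⟨k, hk⟩ := Module.End.mem_maxGenEigenspace _ _ _ |>.mp hu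
    exact (hS u).mpr (smul_mem_range_sylvesterMap ι A B (h lam heig) k u hk)
  have htop : S = ⊤ :=
    top_unique ((Module.End.iSup_maxGenEigenspace_eq_top B.transpose.toLin').ge.trans
      (iSup_le hle))
  intro w
  have hw : w = ∑ i, fun j => (Pi.single i (1 : K) : n → K) j • w i := by
    ext j
    simp [Finset.sum_apply, Pi.single_apply]
  rw [← LinearMap.mem_range, hw]
  exact Submodule.sum_mem _ fun i _ => (hS _).mp (htop ▸ Submodule.mem_top) (w i)


/-- Surjectivity step in the proof of Proposition 4.1: if `ι : V → W` is an injective linear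
map, `A : V → W` is linear, `B` is a `c × c` complex matrix, and `A - λ ι` is surjective for
every root `λ` of the characteristic polynomial of `B`, then the map
`J : V^c → W^c`, `(Jv)_j = A (v j) - ∑ i, B i j • ι (v i)` (i.e. `J v = A v - v B`),
is surjective. -/
theorem stmt_5 (c : ℕ) (hc : 0 < c) (V W : Type*) [AddCommGroup V] [Module ℂ V]
    [AddCommGroup W] [Module ℂ W] (ι : V →ₗ[ℂ] W) (hι : Function.Injective ι)
    (A : V →ₗ[ℂ] W) (B : Matrix (Fin c) (Fin c) ℂ)
    (h : ∀ lam : ℂ, (Matrix.charpoly B).IsRoot lam →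
      Function.Surjective (A - lam • ι : V →ₗ[ℂ] W)) :
    Function.Surjective
      (fun (v : Fin c → V) => fun (j : Fin c) => A (v j) - ∑ i, B i j • ι (v i)) := by
  exact sylvesterMap_surjective ι A B h
end
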